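/- arXiv:1507.02929 — 2 statements merged into one kernel-verified Lean document; each statement's English description precedes it below -/
import Mathlib

section
/- For every natural number n ≥ 4, the number of 3-cliques of the standard spherical triangulation S_n is exactly 3n − 8. -/
/-- The standard spherical triangulation `S_n` on vertex set `{0, 1, ..., n-1}`:
edges are `0–1`; `0–i` and `1–i` for `2 ≤ i ≤ n-1`; and `i–(i+1)` for `2 ≤ i ≤ n-2`. -/
def stdSphere (n : ℕ) : SimpleGraph (Fin n) :=
  SimpleGraph.fromRel (fun i j =>
    (i.val = 0 ∧ j.val = 1) ∨ (i.val = 0 ∧ 2 ≤ j.val) ∨ (i.val = 1 ∧ 2 ≤ j.val) ∨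
      (2 ≤ i.val ∧ j.val = i.val + 1))

theorem stdSphere_adj_of_lt {n : ℕ} {i j : Fin n} (h : i < j) :
    (stdSphere n).Adj i j ↔ i.val ≤ 1 ∨ j.val = i.val + 1 := by
  rw [Fin.lt_def] at h
  simp only [stdSphere, SimpleGraph.fromRel_adj, ne_eq, Fin.ext_iff]
  omega

theorem SimpleGraph.is3Clique_iff_exists_lt {α : Type*} [LinearOrder α] (G : SimpleGraph α)
    (t : Finset α) :
    G.IsNClique 3 t ↔
      ∃ a b c, a < b ∧ b < c ∧ G.Adj a b ∧ G.Adj a c ∧ G.Adj b c ∧ t = {a, b, c} := by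
  rw [SimpleGraph.is3Clique_iff]
  constructor
  · rintro ⟨a, b, c, hab, hac, hbc, rfl⟩
    have hba := hab.symm
    have hca := hac.symm
    have hcb := hbc.symm
    rcases lt_or_gt_of_ne hab.ne with h₁ | h₁ <;> rcases lt_or_gt_of_ne hac.ne with h₂ | h₂ <;>
      rcases lt_or_gt_of_ne hbc.ne with h₃ | h₃
    · exact ⟨a, b, c, h₁, h₃, hab, hac, hbc, rfl⟩
    · exact ⟨a, c, b, h₂, h₃, hac, hab, hcb, by grind⟩
    · exact absurd (h₁.trans h₃) h₂.asymm
    · exact ⟨c, a, b, h₂, h₁, hca, hcb, hab, by grind⟩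
    · exact ⟨b, a, c, h₁, h₂, hba, hbc, hac, by grind⟩
    · exact absurd (h₃.trans h₁) h₂.asymm
    · exact ⟨b, c, a, h₃, h₂, hbc, hba, hca, by grind⟩
    · exact ⟨c, b, a, h₃, h₁, hcb, hca, hba, by grind⟩
  · rintro ⟨a, b, c, -, -, hab, hac, hbc, rfl⟩
    exact ⟨a, b, c, hab, hac, hbc, rfl⟩

theorem Finset.triple_eq_of_lt {α : Type*} [LinearOrder α] {a b c a' b' c' : α}
    (hab : a < b) (hbc : b < c) (hab' : a' < b') (hbc' : b' < c')
    (h : ({a, b, c} : Finset α) = {a', b', c'}) : a = a' ∧ b = b' ∧ c = c' := by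
  have key : ∀ x, (x = a ∨ x = b ∨ x = c) ↔ (x = a' ∨ x = b' ∨ x = c') := fun x => by
    simpa using Finset.ext_iff.mp h x
  have ha := (key a).1 (by simp)
  have hb := (key b).1 (by simp)
  have hc := (key c).1 (by simp)
  grind

/-- The increasing vertex triples of the triangles of `S_{m+4}`: the triangles `{0, 1, i+2}`,
followed by `{0, i+2, i+3}` and `{1, i+2, i+3}`. -/
def stdSphereTriple (m : ℕ) :
    Fin (m + 2) ⊕ Fin (m + 1) ⊕ Fin (m + 1) → Fin (m + 4) × Fin (m + 4) × Fin (m + 4)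
  | .inl i => (⟨0, by omega⟩, ⟨1, by omega⟩, ⟨i + 2, by omega⟩)
  | .inr (.inl i) => (⟨0, by omega⟩, ⟨i + 2, by omega⟩, ⟨i + 3, by omega⟩)
  | .inr (.inr i) => (⟨1, by omega⟩, ⟨i + 2, by omega⟩, ⟨i + 3, by omega⟩)

theorem stdSphereTriple_injective (m : ℕ) : Function.Injective (stdSphereTriple m) := by
  rintro (i | i | i) (j | j | j) h <;>
    simp only [stdSphereTriple, Prod.mk.injEq, Fin.mk.injEq] at h <;>
    first
    | omega
    | (congr; omega)

theorem stdSphereTriple_lt (m : ℕ) (x : Fin (m + 2) ⊕ Fin (m + 1) ⊕ Fin (m + 1)) :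
    (stdSphereTriple m x).1 < (stdSphereTriple m x).2.1 ∧
      (stdSphereTriple m x).2.1 < (stdSphereTriple m x).2.2 := by
  rcases x with i | i | i <;> simp only [stdSphereTriple, Fin.mk_lt_mk] <;> omega

theorem stdSphere_triangle_iff_mem_range (m : ℕ) {a b c : Fin (m + 4)} (hab : a < b)
    (hbc : b < c) :
    ((stdSphere (m + 4)).Adj a b ∧ (stdSphere (m + 4)).Adj a c ∧ (stdSphere (m + 4)).Adj b c) ↔
      ∃ x, stdSphereTriple m x = (a, b, c) := by
  rw [stdSphere_adj_of_lt hab, stdSphere_adj_of_lt (hab.trans hbc), stdSphere_adj_of_lt hbc]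
  obtain ⟨a, ha⟩ := a
  obtain ⟨b, hb⟩ := b
  obtain ⟨c, hc⟩ := c
  rw [Fin.mk_lt_mk] at hab hbc
  constructor
  · rintro ⟨h₁, h₂, h₃⟩
    dsimp only at h₁ h₂ h₃
    rcases Nat.lt_or_ge 1 b with hb1 | hb1
    · rcases Nat.eq_zero_or_pos a with ha0 | ha0
      · refine ⟨.inr (.inl ⟨b - 2, by omega⟩), ?_⟩
        simp only [stdSphereTriple, Prod.mk.injEq, Fin.mk.injEq]
        omega
      · refine ⟨.inr (.inr ⟨b - 2, by omega⟩), ?_⟩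
        simp only [stdSphereTriple, Prod.mk.injEq, Fin.mk.injEq]
        omega
    · refine ⟨.inl ⟨c - 2, by omega⟩, ?_⟩
      simp only [stdSphereTriple, Prod.mk.injEq, Fin.mk.injEq]
      omega
  · rintro ⟨i | i | i, hi⟩ <;>
      simp only [stdSphereTriple, Prod.mk.injEq, Fin.mk.injEq] at hi ⊢ <;> omega

/-- For every `n ≥ 4`, the number of 3-cliques of `S_n` is exactly `3n - 8`. -/
theorem stdSphere_three_cliques (n : ℕ) (hn : 4 ≤ n) :
    {t : Finset (Fin n) | (stdSphere n).IsNClique 3 t}.ncard = 3 * n - 8 := by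
  obtain ⟨m, rfl⟩ := Nat.exists_eq_add_of_le' hn
  let f (x : Fin (m + 2) ⊕ Fin (m + 1) ⊕ Fin (m + 1)) : Finset (Fin (m + 4)) :=
    {(stdSphereTriple m x).1, (stdSphereTriple m x).2.1, (stdSphereTriple m x).2.2}
  have hf : Function.Injective f := fun x y h => by
    obtain ⟨hx₁, hx₂⟩ := stdSphereTriple_lt m x
    obtain ⟨hy₁, hy₂⟩ := stdSphereTriple_lt m y
    obtain ⟨h₁, h₂, h₃⟩ := Finset.triple_eq_of_lt hx₁ hx₂ hy₁ hy₂ h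
    exact stdSphereTriple_injective m (Prod.ext h₁ (Prod.ext h₂ h₃))
  have hrange : {t : Finset (Fin (m + 4)) | (stdSphere (m + 4)).IsNClique 3 t} = Set.range f := by
    ext t
    rw [Set.mem_ofPred_eq, SimpleGraph.is3Clique_iff_exists_lt, Set.mem_range]
    constructor
    · rintro ⟨a, b, c, hab, hbc, h₁, h₂, h₃, rfl⟩
      obtain ⟨x, hx⟩ := (stdSphere_triangle_iff_mem_range m hab hbc).1 ⟨h₁, h₂, h₃⟩
      exact ⟨x, by simp only [f, hx]⟩
    · rintro ⟨x, rfl⟩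
      obtain ⟨hx₁, hx₂⟩ := stdSphereTriple_lt m x
      obtain ⟨h₁, h₂, h₃⟩ := (stdSphere_triangle_iff_mem_range m hx₁ hx₂).2 ⟨x, rfl⟩
      exact ⟨_, _, _, hx₁, hx₂, h₁, h₂, h₃, rfl⟩
  rw [hrange, ← Nat.card_coe_set_eq, Nat.card_range_of_injective hf, Nat.card_eq_fintype_card]
  simp only [Fintype.card_sum, Fintype.card_fin]
  omega
end

section
/- For every natural number n ≥ 4, the standard spherical triangulation S_n contains a 4-clique but contains no 5-clique; that is, its clique number is exactly 4. -/
/-- Colouring `0` and `1` separately and the remaining path by parity is proper. -/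
theorem stdSphere_colorable (n : ℕ) : (stdSphere n).Colorable 4 := by
  refine ⟨SimpleGraph.Coloring.mk
    (fun v => if h : v.val < 2 then ⟨v.val, by lia⟩ else ⟨2 + v.val % 2, by lia⟩) ?_⟩
  intro v w h
  simp only [stdSphere, SimpleGraph.fromRel_adj] at h
  split_ifs <;> simp only [ne_eq, Fin.ext_iff] <;> lia

/-- For every `n ≥ 4`, `S_n` contains a 4-clique but no 5-clique: its clique number is 4. -/
theorem stdSphere_clique_number (n : ℕ) (hn : 4 ≤ n) :
    (∃ t : Finset (Fin n), (stdSphere n).IsNClique 4 t) ∧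
      ∀ t : Finset (Fin n), ¬ (stdSphere n).IsNClique 5 t := by
  refine ⟨⟨Finset.univ.map (Fin.castLEEmb hn), ?_⟩, (stdSphere_colorable n).cliqueFree (by lia)⟩
  rw [SimpleGraph.isNClique_iff]
  refine ⟨?_, by simp⟩
  intro a ha b hb hab
  have ha4 : a.val < 4 := by simpa using ha
  have hb4 : b.val < 4 := by simpa using hb
  simp only [stdSphere, SimpleGraph.fromRel_adj]
  refine ⟨hab, ?_⟩
  rw [ne_eq, Fin.ext_iff] at hab
  lia
end
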